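/- Let n ≥ 3, let Rm be any 4-index real array indexed by Fin n, let A be a symmetric n×n real matrix with trace R, and let Å = A - (R/n)·I be its trace-free part. Define the 4-index array W by W_{ijkl} = Rm_{ijkl} - (1/(n-2))·(A ⍽ I)_{ijkl} + (R/(2(n-1)(n-2)))·(I ⍽ I)_{ijkl}. Then Σ_{i,j,k} A_{ij}A_{ik}A_{jk} - Σ_{i,j,k,l} Rm_{ijkl}A_{ik}A_{jl} = (n/(n-2))·tr(Å³) + (R/(n-1))·tr(Å²) - Σ_{i,j,k,l} W_{ijkl}A_{ik}A_{jl}. (This is the pointwise algebraic content of Lemma 2.1(ii), with Rm the Riemann tensor, A the Ricci tensor, and W the Weyl tensor defined by the standard curvature decomposition.) -/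

import Mathlib

/-- The Kulkarni–Nomizu product of two symmetric `(0,2)`-tensors on `ℝⁿ`,
viewed as `n × n` real matrices:
`(S ⍽ T)_{ijkl} = S_{ik} T_{jl} + S_{jl} T_{ik} - S_{il} T_{jk} - S_{jk} T_{il}`. -/
def kulkarniNomizu {n : ℕ} (S T : Matrix (Fin n) (Fin n) ℝ)
    (i j k l : Fin n) : ℝ :=
  S i k * T j l + S j l * T i k - S i l * T j k - S j k * T i l

/-- The cubic contraction of a symmetric matrix is the trace of its cube. -/
lemma sum_mul_mul_eq_trace_pow_three {n : ℕ} {A : Matrix (Fin n) (Fin n) ℝ} (hA : A.IsSymm) :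
    ∑ i, ∑ j, ∑ k, A i j * A i k * A j k = (A ^ 3).trace := by
  simp only [pow_three', Matrix.trace, Matrix.diag_apply, Matrix.mul_apply, Finset.sum_mul]
  refine Finset.sum_congr rfl fun i _ => ?_
  rw [Finset.sum_comm]
  refine Finset.sum_congr rfl fun k _ => Finset.sum_congr rfl fun j _ => ?_
  rw [hA.apply i k]
  ring

/-- The square contraction of a symmetric matrix is the trace of its square. -/
lemma sum_mul_self_eq_trace_sq {n : ℕ} {A : Matrix (Fin n) (Fin n) ℝ} (hA : A.IsSymm) :
    ∑ i, ∑ j, A i j * A i j = (A ^ 2).trace := by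
  simp only [sq, Matrix.trace, Matrix.diag_apply, Matrix.mul_apply]
  exact Finset.sum_congr rfl fun i _ => Finset.sum_congr rfl fun j _ => by rw [hA.apply i j]

/-- Contraction of `A ⍽ I` against `A ⊗ A`. -/
lemma sum_kulkarniNomizu_one_right {n : ℕ} {A : Matrix (Fin n) (Fin n) ℝ} (hA : A.IsSymm) :
    ∑ i, ∑ j, ∑ k, ∑ l, kulkarniNomizu A 1 i j k l * A i k * A j l
      = 2 * A.trace * (A ^ 2).trace - 2 * (A ^ 3).trace := by
  have h₁ : ∑ i, ∑ j, ∑ k, A i k * A i k * A j j = A.trace * (A ^ 2).trace := by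
    simp only [← Finset.sum_mul, ← Finset.mul_sum, sum_mul_self_eq_trace_sq hA, Matrix.trace,
      Matrix.diag_apply, mul_comm]
  have h₂ : ∑ i, ∑ j, ∑ l, A j l * A i i * A j l = A.trace * (A ^ 2).trace := by
    rw [← sum_mul_self_eq_trace_sq hA, Matrix.trace, Finset.sum_mul]
    simp only [Matrix.diag_apply, Finset.mul_sum]
    exact Finset.sum_congr rfl fun i _ => Finset.sum_congr rfl fun j _ =>
      Finset.sum_congr rfl fun l _ => by ring
  have h₃ : ∑ i, ∑ j, ∑ l, A i l * A i j * A j l = (A ^ 3).trace := by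
    rw [← sum_mul_mul_eq_trace_pow_three hA]
    simp only [mul_comm (A _ _) (A _ _)]
  have h₄ : ∑ i, ∑ j, ∑ k, A j k * A i k * A j i = (A ^ 3).trace := by
    rw [← sum_mul_mul_eq_trace_pow_three hA]
    exact Finset.sum_congr rfl fun i _ => Finset.sum_congr rfl fun j _ =>
      Finset.sum_congr rfl fun k _ => by rw [hA.apply i j]; ring
  simp only [kulkarniNomizu, Matrix.one_apply, add_mul, sub_mul, Finset.sum_add_distrib,
    Finset.sum_sub_distrib, mul_ite, ite_mul, mul_one, mul_zero, zero_mul, Finset.sum_ite_eq,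
    Finset.sum_ite_irrel, Finset.sum_const_zero, Finset.mem_univ, if_true]
  rw [h₁, h₂, h₃, h₄]
  ring

/-- Contraction of `I ⍽ I` against `A ⊗ A`. -/
lemma sum_kulkarniNomizu_one_one {n : ℕ} (A : Matrix (Fin n) (Fin n) ℝ) :
    ∑ i, ∑ j, ∑ k, ∑ l,
        kulkarniNomizu (1 : Matrix (Fin n) (Fin n) ℝ) (1 : Matrix (Fin n) (Fin n) ℝ) i j k l
          * A i k * A j l
      = 2 * A.trace ^ 2 - 2 * (A ^ 2).trace := by
  have h₁ : ∑ i, ∑ j, A i i * A j j = A.trace ^ 2 := by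
    simp only [sq, Matrix.trace, Matrix.diag_apply, Finset.sum_mul_sum]
  have h₂ : ∑ i, ∑ j, A i j * A j i = (A ^ 2).trace := by
    simp only [sq, Matrix.trace, Matrix.diag_apply, Matrix.mul_apply]
  simp only [kulkarniNomizu, Matrix.one_apply, add_mul, sub_mul, Finset.sum_add_distrib,
    Finset.sum_sub_distrib, mul_ite, ite_mul, mul_one, one_mul, mul_zero, zero_mul,
    Finset.sum_ite_eq, Finset.sum_ite_irrel, Finset.sum_const_zero, Finset.mem_univ, if_true]
  rw [h₁, h₂]
  ring

/-- The trace of the square of `A - c • 1`. -/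
lemma trace_sub_smul_one_sq {n : ℕ} (A : Matrix (Fin n) (Fin n) ℝ) (c : ℝ) :
    ((A - c • 1) ^ 2).trace = (A ^ 2).trace - 2 * c * A.trace + c ^ 2 * n := by
  have h : (A - c • 1) ^ 2 = A ^ 2 - (2 * c) • A + c ^ 2 • (1 : Matrix (Fin n) (Fin n) ℝ) := by
    simp only [sq, sub_mul, mul_sub, smul_mul_assoc, mul_smul_comm, one_mul, mul_one, smul_sub]
    module
  simp [h]

/-- The trace of the cube of `A - c • 1`. -/
lemma trace_sub_smul_one_pow_three {n : ℕ} (A : Matrix (Fin n) (Fin n) ℝ) (c : ℝ) :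
    ((A - c • 1) ^ 3).trace
      = (A ^ 3).trace - 3 * c * (A ^ 2).trace + 3 * c ^ 2 * A.trace - c ^ 3 * n := by
  have h : (A - c • 1) ^ 3
      = A ^ 3 - (3 * c) • A ^ 2 + (3 * c ^ 2) • A - c ^ 3 • (1 : Matrix (Fin n) (Fin n) ℝ) := by
    simp only [pow_three, sq, sub_mul, mul_sub, smul_mul_assoc, mul_smul_comm, one_mul, mul_one,
      smul_sub]
    module
  simp [h]

/-- Lemma 2.1(ii), pointwise algebraic form: with `Rm` an arbitrary 4-index array
(the Riemann tensor at a point), `A` a symmetric matrix with trace `R` (the Ricci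
tensor), `Aring` its trace-free part, and `W` the Weyl tensor defined by the standard
curvature decomposition, one has
`Σ A_{ij}A_{ik}A_{jk} - Σ Rm_{ijkl}A_{ik}A_{jl}`
`  = (n/(n-2)) tr(Aring³) + (R/(n-1)) tr(Aring²) - Σ W_{ijkl}A_{ik}A_{jl}`. -/
theorem stmt_3 (n : ℕ) (hn : 3 ≤ n)
    (Rm : Fin n → Fin n → Fin n → Fin n → ℝ)
    (A : Matrix (Fin n) (Fin n) ℝ) (hA : A.IsSymm)
    (R : ℝ) (hR : R = A.trace)
    (Aring : Matrix (Fin n) (Fin n) ℝ) (hAring : Aring = A - (R / n) • 1)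
    (W : Fin n → Fin n → Fin n → Fin n → ℝ)
    (hW : ∀ i j k l, W i j k l = Rm i j k l
        - (1 / ((n : ℝ) - 2)) * kulkarniNomizu A (1 : Matrix (Fin n) (Fin n) ℝ) i j k l
        + (R / (2 * ((n : ℝ) - 1) * ((n : ℝ) - 2)))
            * kulkarniNomizu (1 : Matrix (Fin n) (Fin n) ℝ)
                (1 : Matrix (Fin n) (Fin n) ℝ) i j k l) :
    (∑ i : Fin n, ∑ j : Fin n, ∑ k : Fin n, A i j * A i k * A j k)
      - (∑ i : Fin n, ∑ j : Fin n, ∑ k : Fin n, ∑ l : Fin n,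
          Rm i j k l * A i k * A j l)
    = ((n : ℝ) / ((n : ℝ) - 2)) * (Aring ^ 3).trace
      + (R / ((n : ℝ) - 1)) * (Aring ^ 2).trace
      - (∑ i : Fin n, ∑ j : Fin n, ∑ k : Fin n, ∑ l : Fin n,
          W i j k l * A i k * A j l) := by
  have hWsum : ∑ i, ∑ j, ∑ k, ∑ l, W i j k l * A i k * A j l
      = ∑ i, ∑ j, ∑ k, ∑ l, Rm i j k l * A i k * A j l
        - (1 / ((n : ℝ) - 2)) * (2 * R * (A ^ 2).trace - 2 * (A ^ 3).trace)
        + (R / (2 * ((n : ℝ) - 1) * ((n : ℝ) - 2))) * (2 * R ^ 2 - 2 * (A ^ 2).trace) := by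
    rw [hR, ← sum_kulkarniNomizu_one_right hA, ← sum_kulkarniNomizu_one_one A, ← hR]
    simp only [hW, Finset.mul_sum, ← Finset.sum_add_distrib, ← Finset.sum_sub_distrib]
    exact Finset.sum_congr rfl fun i _ => Finset.sum_congr rfl fun j _ =>
      Finset.sum_congr rfl fun k _ => Finset.sum_congr rfl fun l _ => by ring
  have hn' : (3 : ℝ) ≤ n := by exact_mod_cast hn
  have h₀ : (n : ℝ) ≠ 0 := by linarith
  have h₁ : (n : ℝ) - 1 ≠ 0 := by linarith
  have h₂ : (n : ℝ) - 2 ≠ 0 := by linarith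
  rw [hWsum, sum_mul_mul_eq_trace_pow_three hA, hAring, trace_sub_smul_one_sq,
    trace_sub_smul_one_pow_three, ← hR]
  field_simp
  ring
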